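/- Let I ⊆ V be a subset with |I| = n−1 such that there is exactly one index a with {a, ā} ⊆ V∖I. Then the identity ∏_{i∈I} M_i = Δ'_{V∖(I∪{a})} + Δ'_{V∖(I∪{ā})} holds as functions V → R (pointwise product and sum), where both V∖(I∪{a}) and V∖(I∪{ā}) are independent subsets of size n. -/

import Mathlib

open MvPolynomial Finset

noncomputable section

abbrev Rr (n : ℕ) := MvPolynomial (Fin n) ℤ

/-- The "opposite" vertex: 0-indexed version of i ↦ 2n+1−i. -/
def bar {n : ℕ} (i : Fin (2*n)) : Fin (2*n) :=
  ⟨2*n - 1 - i.val, by have := i.isLt; omega⟩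

/-- The weight α_i (0-indexed): α_i = X i for i < n, and α_i = −α_{bar i} otherwise. -/
def av {n : ℕ} (i : Fin (2*n)) : Rr n :=
  if h : i.val < n then X ⟨i.val, h⟩
  else - X ⟨2*n - 1 - i.val, by have := i.isLt; omega⟩

/-- The axial function α(ij). -/
def ax {n : ℕ} (i j : Fin (2*n)) : Rr n :=
  if j = bar i then - av i else - av i + av j

/-- The class M_v. -/
def Mv {n : ℕ} (v : Fin (2*n)) : Fin (2*n) → Rr n := fun j =>
  if j = v then 0 else if j = bar v then 2 * av v else - av j + av v

/-- The class Q. -/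
def Qf {n : ℕ} : Fin (2*n) → Rr n := fun j => - av j

/-- Independence: K contains no pair {i, bar i}. -/
def indep {n : ℕ} (K : Finset (Fin (2*n))) : Prop :=
  ∀ i : Fin (2*n), ¬ ({i, bar i} : Finset (Fin (2*n))) ⊆ K

/-- The class Δ_K. -/
def Del {n : ℕ} (K : Finset (Fin (2*n))) : Fin (2*n) → Rr n := fun j =>
  if j ∈ K then ∏ k ∈ Kᶜ, ax j k else 0

/-- The class Δ'_K. -/
def Del' {n : ℕ} (K : Finset (Fin (2*n))) : Fin (2*n) → Rr n := fun j =>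
  if j ∈ K then ∏ k ∈ (K ∪ {bar j})ᶜ, ax j k else 0

/-- The graph equivariant cohomology H*(GQ_{2n−1}) as a subring of the ring of
functions V → R with pointwise operations. -/
def HGQ (n : ℕ) : Subring (Fin (2*n) → Rr n) where
  carrier := {f | ∀ i j : Fin (2*n), i ≠ j → ax i j ∣ f i - f j}
  zero_mem' := fun i j _ => by simp
  one_mem' := fun i j _ => by simp
  add_mem' := by
    intro a b ha hb i j h
    have e : (a + b) i - (a + b) j = (a i - a j) + (b i - b j) := by
      simp only [Pi.add_apply]; ring
    rw [e]; exact dvd_add (ha i j h) (hb i j h)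
  neg_mem' := by
    intro a ha i j h
    have e : (-a) i - (-a) j = -(a i - a j) := by
      simp only [Pi.neg_apply]; ring
    rw [e]; exact dvd_neg.mpr (ha i j h)
  mul_mem' := by
    intro a b ha hb i j h
    have e : (a * b) i - (a * b) j = a i * (b i - b j) + (a i - a j) * b j := by
      simp only [Pi.mul_apply]; ring
    rw [e]; exact dvd_add ((hb i j h).mul_left _) ((ha i j h).mul_right _)

/-- The graph equivariant cohomology H*(GQ_{2n−2}) (edges i j with j ≠ bar i only). -/
def HGQe (n : ℕ) : Subring (Fin (2*n) → Rr n) where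
  carrier := {f | ∀ i j : Fin (2*n), i ≠ j → j ≠ bar i → ax i j ∣ f i - f j}
  zero_mem' := fun i j _ _ => by simp
  one_mem' := fun i j _ _ => by simp
  add_mem' := by
    intro a b ha hb i j h h'
    have e : (a + b) i - (a + b) j = (a i - a j) + (b i - b j) := by
      simp only [Pi.add_apply]; ring
    rw [e]; exact dvd_add (ha i j h h') (hb i j h h')
  neg_mem' := by
    intro a ha i j h h'
    have e : (-a) i - (-a) j = -(a i - a j) := by
      simp only [Pi.neg_apply]; ring
    rw [e]; exact dvd_neg.mpr (ha i j h h')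
  mul_mem' := by
    intro a b ha hb i j h h'
    have e : (a * b) i - (a * b) j = a i * (b i - b j) + (a i - a j) * b j := by
      simp only [Pi.mul_apply]; ring
    rw [e]; exact dvd_add ((hb i j h h').mul_left _) ((ha i j h h').mul_right _)


theorem bar_bar {n : ℕ} (i : Fin (2*n)) : bar (bar i) = i := by
  apply Fin.ext
  have := i.isLt
  simp only [bar]
  omega

theorem bar_ne_self {n : ℕ} (i : Fin (2*n)) : bar i ≠ i := by
  intro h
  have h' := congrArg Fin.val h
  have := i.isLt
  simp only [bar] at h'
  omega

theorem av_bar {n : ℕ} (i : Fin (2*n)) : av (bar i) = - av i := by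
  have hi := i.isLt
  by_cases h : i.val < n
  · have h' : ¬ (bar i).val < n := by simp only [bar]; omega
    rw [av, dif_neg h', av, dif_pos h]
    congr 3
    simp only [bar]
    omega
  · have h' : (bar i).val < n := by simp only [bar]; omega
    rw [av, dif_pos h', av, dif_neg h, neg_neg]
    rfl

theorem Mv_of_ne {n : ℕ} {v j : Fin (2*n)} (h : j ≠ v) (h' : v ≠ bar j) :
    Mv v j = - av j + av v := by
  have h'' : j ≠ bar v := fun e => h' (by rw [e, bar_bar])
  rw [Mv, if_neg h, if_neg h'']

theorem Mv_bar_self {n : ℕ} (j : Fin (2*n)) : Mv (bar j) j = - (2 * av j) := by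
  rw [Mv, if_neg (bar_ne_self j).symm, bar_bar, if_pos rfl, av_bar, mul_neg]

theorem Del'_compl {n : ℕ} (L : Finset (Fin (2*n))) (j : Fin (2*n)) :
    Del' Lᶜ j = if j ∈ L then 0 else ∏ k ∈ L.erase (bar j), (- av j + av k) := by
  have hL : (Lᶜ ∪ {bar j})ᶜ = L.erase (bar j) := by
    ext k
    simp only [mem_compl, mem_union, mem_singleton, mem_erase]
    tauto
  by_cases h : j ∈ L
  · rw [Del', if_neg (by simpa using h), if_pos h]
  · rw [Del', if_pos (by simpa using h), if_neg h, hL]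
    exact prod_congr rfl fun k hk => if_neg (ne_of_mem_erase hk)

/-- If `I` contains neither `j` nor `bar j`, only the class `Δ'` of the complement of
`I ∪ {bar j}` contributes at `j`. -/
theorem prod_Mv_apply_of_bar_notMem {n : ℕ} {I : Finset (Fin (2*n))} {j : Fin (2*n)}
    (hj : j ∉ I) (hb : bar j ∉ I) :
    (∏ i ∈ I, Mv i j) = Del' ((I ∪ {j})ᶜ) j + Del' ((I ∪ {bar j})ᶜ) j := by
  have hnot : j ∉ I ∪ {bar j} := by
    simp [hj, (bar_ne_self j).symm]
  have he : (I ∪ {bar j}).erase (bar j) = I := by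
    rw [union_comm, ← insert_eq, erase_insert hb]
  rw [Del'_compl, Del'_compl, if_pos (by simp), if_neg hnot, he, zero_add]
  exact prod_congr rfl fun i hi =>
    Mv_of_ne (fun e => hj (e ▸ hi)) (fun e => hb (e ▸ hi))

theorem Del'_compl_union_singleton {n : ℕ} {I : Finset (Fin (2*n))} {a j : Fin (2*n)}
    (hj : j ∉ I) (ha : a ∉ I) (hja : j ≠ a) (hjb : a ≠ bar j) :
    Del' ((I ∪ {a})ᶜ) j = (- av j + av a) * ∏ k ∈ I.erase (bar j), (- av j + av k) := by
  have hnot : j ∉ I ∪ {a} := by simp [hj, hja]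
  rw [Del'_compl, if_neg hnot, union_comm, ← insert_eq, erase_insert_of_ne hjb,
    prod_insert (fun h => ha (mem_of_mem_erase h))]

/-- if |I| = n−1 and there is exactly one index a with {a, ā} ⊆ V∖I, then
∏_{i∈I} M_i = Δ'_{V∖(I∪{a})} + Δ'_{V∖(I∪{ā})} pointwise. -/
theorem stmt16 (n : ℕ) (hn : 1 ≤ n) (I : Finset (Fin (2*n))) (hI : I.card = n - 1)
    (a : Fin (2*n)) (ha : ({a, bar a} : Finset (Fin (2*n))) ⊆ Iᶜ)
    (huniq : ∀ b : Fin (2*n), ({b, bar b} : Finset (Fin (2*n))) ⊆ Iᶜ →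
      b = a ∨ b = bar a) :
    ∏ i ∈ I, Mv i = Del' ((I ∪ {a})ᶜ) + Del' ((I ∪ {bar a})ᶜ) := by
  have haI : a ∉ I := mem_compl.mp (ha (by simp))
  have hbI : bar a ∉ I := mem_compl.mp (ha (by simp))
  funext j
  rw [Finset.prod_apply, Pi.add_apply]
  by_cases hj : j ∈ I
  · rw [Del'_compl, Del'_compl, if_pos (mem_union_left _ hj), if_pos (mem_union_left _ hj),
      add_zero]
    exact prod_eq_zero hj (if_pos rfl)
  by_cases hja : j = a
  · subst hja
    exact prod_Mv_apply_of_bar_notMem haI hbI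
  by_cases hjb : j = bar a
  · subst hjb
    have h := prod_Mv_apply_of_bar_notMem hbI (by rwa [bar_bar])
    rwa [bar_bar, add_comm] at h
  have hbj : bar j ∈ I := by
    by_contra hbj
    have hsub : ({j, bar j} : Finset (Fin (2*n))) ⊆ Iᶜ := by
      simp [insert_subset_iff, hj, hbj]
    exact (huniq j hsub).elim hja hjb
  have hab : a ≠ bar j := fun e => hjb (by rw [e, bar_bar])
  have hbb : bar a ≠ bar j := fun e => hja (by rw [← bar_bar j, ← e, bar_bar])
  have hrest : ∏ i ∈ I.erase (bar j), Mv i j = ∏ i ∈ I.erase (bar j), (- av j + av i) :=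
    prod_congr rfl fun i hi =>
      Mv_of_ne (fun e => hj (e ▸ mem_of_mem_erase hi)) (ne_of_mem_erase hi)
  rw [Del'_compl_union_singleton hj haI hja hab, Del'_compl_union_singleton hj hbI hjb hbb,
    ← mul_prod_erase I (fun i => Mv i j) hbj, hrest, Mv_bar_self, av_bar]
  ring

end
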